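/- arXiv:2201.12941 — 3 statements merged into one kernel-verified Lean document; each statement's English description precedes it below -/
import Mathlib

section
/- Fix s_0 > 0 and a compact set K ⊂ ℂ∖[−a,0]. There exist constants C > 0 and n_0 ≥ 1 such that for all integers n ≥ n_0, all s ≥ −s_0 and all z ∈ K, | q_n(z|s) − n^{−1/3} q^{(1)}(z|s) | ≤ C n^{−2/3} and | d/dz q_n(z|s) | ≤ C n^{−1/3}, where q^{(1)}(z|s) = F_{−1/2}(s) / (2π a^{1/2} t^{1/2} m(z)^{1/2}). -/
open MeasureTheory

lemma aux_log_diff (A B m : ℝ) (hA : m ≤ A) (hB : m ≤ B) :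
    |Real.log (1 + Real.exp (-A)) - Real.log (1 + Real.exp (-B))| ≤ |A - B| * Real.exp (-m) := by
  wlog h : A ≤ B generalizing A B
  · rw [abs_sub_comm, abs_sub_comm A B]
    exact this B A hB hA (le_of_not_ge h)
  have e1 : Real.exp (-B) ≤ Real.exp (-A) := Real.exp_le_exp.2 (by linarith)
  have p1 := Real.exp_pos (-B)
  have p2 := Real.exp_pos (-A)
  have h1 : Real.log (1 + Real.exp (-B)) ≤ Real.log (1 + Real.exp (-A)) :=
    Real.log_le_log (by linarith) (by linarith)
  rw [abs_of_nonneg (by linarith), abs_of_nonpos (by linarith)]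
  rw [← Real.log_div (by linarith) (by linarith)]
  have h2 := Real.log_le_sub_one_of_pos (x := (1 + Real.exp (-A)) / (1 + Real.exp (-B))) (by positivity)
  have h3 : (1 + Real.exp (-A)) / (1 + Real.exp (-B)) - 1 ≤ Real.exp (-A) - Real.exp (-B) := by
    rw [div_sub_one (by linarith), div_le_iff₀ (by linarith)]
    nlinarith
  have h4 : Real.exp (-B) = Real.exp (-A) * Real.exp (-(B-A)) := by
    rw [← Real.exp_add]; congr 1; ring
  have h5 := Real.add_one_le_exp (-(B-A))
  have h6 : Real.exp (-A) ≤ Real.exp (-m) := Real.exp_le_exp.2 (by linarith)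
  nlinarith

lemma aux_log_le (A : ℝ) : Real.log (1 + Real.exp A) ≤ Real.exp A := by
  have := Real.log_le_sub_one_of_pos (x := 1 + Real.exp A) (by positivity)
  linarith

lemma aux_log_nonneg (A : ℝ) : 0 ≤ Real.log (1 + Real.exp A) :=
  Real.log_nonneg (by have := Real.exp_pos A; linarith)

lemma aux_exp1 (y : ℝ) (hy : 0 < y) : Real.exp (-y) ≤ 1 / y := by
  rw [Real.exp_neg, ← one_div]
  apply one_div_le_one_div_of_le hy
  have := Real.add_one_le_exp y
  linarith

lemma aux_exp2 (y : ℝ) (hy : 0 < y) : y ^ 2 * Real.exp (-y) ≤ 2 := by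
  rw [Real.exp_neg, ← div_eq_mul_inv, div_le_iff₀ (Real.exp_pos _)]
  have := Real.quadratic_le_exp_of_nonneg hy.le
  linarith

lemma aux_w_int (a : ℝ) (ha : 0 < a) :
    IntegrableOn (fun u : ℝ => (Real.sqrt (u * (a - u)))⁻¹) (Set.Ioo 0 a) := by
  have h1 : IntervalIntegrable (fun u : ℝ => u ^ (-(1:ℝ)/2)) volume 0 a :=
    intervalIntegral.intervalIntegrable_rpow' (by norm_num)
  have h2 : IntervalIntegrable (fun u : ℝ => (a - u) ^ (-(1:ℝ)/2)) volume 0 a := by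
    have := (h1.comp_sub_left a).symm
    simpa using this
  have h3 := ((h1.add h2).const_mul (1 / Real.sqrt a))
  rw [intervalIntegrable_iff_integrableOn_Ioo_of_le ha.le] at h3
  refine Integrable.mono' h3 ?_ ?_
  · apply Measurable.aestronglyMeasurable
    fun_prop
  · refine (ae_restrict_mem measurableSet_Ioo).mono ?_
    intro u hu
    have hu0 := hu.1
    have hv0 : 0 < a - u := by linarith [hu.2]
    have e : ∀ x : ℝ, 0 < x → x ^ (-(1:ℝ)/2) = (Real.sqrt x)⁻¹ := by
      intro x hx
      rw [Real.sqrt_eq_rpow, ← Real.rpow_neg hx.le]; norm_num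
    show _ ≤ 1 / Real.sqrt a * (u ^ (-(1:ℝ)/2) + (a - u) ^ (-(1:ℝ)/2))
    rw [e u hu0, e _ hv0, Real.norm_of_nonneg (by positivity), Real.sqrt_mul hu0.le]
    have s1 := Real.sqrt_pos.2 hu0
    have s2 := Real.sqrt_pos.2 hv0
    have s3 := Real.sqrt_pos.2 ha
    have : Real.sqrt a ≤ Real.sqrt u + Real.sqrt (a - u) := by
      apply Real.sqrt_le_iff.2 ⟨by positivity, ?_⟩
      nlinarith [Real.sq_sqrt hu0.le, Real.sq_sqrt hv0.le]
    have e2 : 1 / Real.sqrt a * ((Real.sqrt u)⁻¹ + (Real.sqrt (a-u))⁻¹) = (Real.sqrt u * Real.sqrt (a-u))⁻¹ * ((Real.sqrt u + Real.sqrt (a-u)) / Real.sqrt a) := by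
      field_simp; ring
    rw [e2]
    apply le_mul_of_one_le_right (by positivity)
    rwa [one_le_div s3]

lemma aux_Q (a t : ℝ) (ha : 0 < a) (ht : 0 < t)
    (Q : ℝ → ℝ)
    (hQcont : ContinuousOn Q (Set.Icc (-a) 0))
    (hQpos : ∀ x ∈ Set.Ico (-a) (0 : ℝ), 0 < Q x)
    (hQ0 : Q 0 = 0)
    (hQsm : ∃ U : Set ℝ, IsOpen U ∧ (0 : ℝ) ∈ U ∧ ContDiffOn ℝ (⊤ : ℕ∞) Q U)
    (hQder : deriv Q 0 = -t) :
    ∃ c > 0, c ≤ t ∧ ∃ M > 0, ∀ u ∈ Set.Ioo 0 a, c * u ≤ Q (-u) ∧ |Q (-u) - t * u| ≤ M * u ^ 2 := by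
  obtain ⟨U, hU, h0, hs⟩ := hQsm
  set G : ℝ → ℝ := fun u => Q (-u) with hG
  have hGU : ContDiffOn ℝ (⊤ : ℕ∞) G (Neg.neg ⁻¹' U) :=
    hs.comp contDiff_neg.contDiffOn (fun x hx => hx)
  have hVo : IsOpen (Neg.neg ⁻¹' U : Set ℝ) := hU.preimage continuous_neg
  obtain ⟨δ, hδ, hball⟩ := Metric.isOpen_iff.1 hVo 0 (by simpa using h0)
  have hIcc : Set.Icc 0 (δ/2) ⊆ (Neg.neg ⁻¹' U : Set ℝ) := by
    intro x hx
    apply hball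
    rw [Metric.mem_ball, Real.dist_eq, sub_zero, abs_of_nonneg hx.1]
    linarith [hx.2]
  have hQd : HasDerivAt Q (-t) 0 := by
    rw [← hQder]
    apply DifferentiableAt.hasDerivAt
    exact ((hs.contDiffAt (hU.mem_nhds h0)).differentiableAt (by simp))
  have hGd : HasDerivAt G t 0 := by
    have : HasDerivAt Q (-t) (-0) := by simpa using hQd
    have := this.comp (0:ℝ) (hasDerivAt_neg (0:ℝ))
    have h2 : HasDerivAt G (-t * -1) 0 := this
    simpa using h2
  obtain ⟨C, hC⟩ := exists_taylor_mean_remainder_bound (f := G) (n := 1) (a := 0) (b := δ/2) (by linarith)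
    ((hGU.mono hIcc).of_le (by norm_cast))
  have hC' : ∀ u ∈ Set.Icc 0 (δ/2), |G u - t * u| ≤ C * u ^ 2 := by
    intro u hu
    have := hC u hu
    have hd : derivWithin G (Set.Icc 0 (δ/2)) 0 = t :=
      hGd.hasDerivWithinAt.derivWithin ((uniqueDiffOn_Icc (by linarith)) 0 ⟨le_rfl, by linarith⟩)
    rw [taylorWithinEval_succ] at this
    have hG0 : G 0 = 0 := by simp [hG, hQ0]
    simp [hd, hG0] at this
    rw [mul_comm t]
    exact this
  set M1 := max C 1
  have hM1 : 0 < M1 := by positivity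
  set e := min (min (δ/2) (t/(2*M1))) a
  have he : 0 < e := by positivity
  have hcont : ContinuousOn G (Set.Icc e a) := by
    apply hQcont.comp continuous_neg.continuousOn
    intro x hx
    simp at hx ⊢
    constructor <;> linarith [hx.1, hx.2]
  have hne : (Set.Icc e a).Nonempty := Set.nonempty_Icc.2 (min_le_right _ _)
  obtain ⟨x0, hx0, hmin⟩ := isCompact_Icc.exists_isMinOn hne hcont
  obtain ⟨x1, hx1, hmax⟩ := isCompact_Icc.exists_isMaxOn hne hcont
  have hm : 0 < G x0 := hQpos _ (by simp at hx0 ⊢; constructor <;> linarith [hx0.1, hx0.2])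
  have hB : 0 < G x1 := hQpos _ (by simp at hx1 ⊢; constructor <;> linarith [hx1.1, hx1.2])
  refine ⟨min (t/2) (G x0 / a), by positivity, (min_le_left _ _).trans (by linarith),
    max M1 ((G x1 + t * a) / e^2), by positivity, ?_⟩
  intro u hu
  by_cases hue : u ≤ e
  · have h1 : u ≤ δ/2 := hue.trans ((min_le_left _ _).trans (min_le_left _ _))
    have h2 : u ≤ t/(2*M1) := hue.trans ((min_le_left _ _).trans (min_le_right _ _))
    rw [le_div_iff₀ (by positivity)] at h2
    have h3 := hC' u ⟨hu.1.le, h1⟩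
    have h4 : |G u - t * u| ≤ M1 * u^2 := h3.trans (by gcongr; exact le_max_left _ _)
    refine ⟨?_, h4.trans (by gcongr; exact le_max_left _ _)⟩
    have h5 := (abs_le.1 h4).1
    have h6 : min (t/2) (G x0 / a) * u ≤ t/2 * u := by
      have := hu.1
      gcongr; exact min_le_left _ _
    show _ ≤ G u
    nlinarith [hu.1]
  · push Not at hue
    have hmem : u ∈ Set.Icc e a := ⟨hue.le, hu.2.le⟩
    have h1 : G x0 ≤ G u := hmin hmem
    have h2 : G u ≤ G x1 := hmax hmem
    have hu1 := hu.1
    constructor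
    · show _ ≤ G u
      calc _ ≤ G x0 / a * u := by gcongr; exact min_le_right _ _
        _ ≤ G x0 / a * a := by gcongr; exact hu.2.le
        _ = G x0 := by field_simp
        _ ≤ _ := h1
    · calc |G u - t * u| ≤ G x1 + t * a := by
            rw [abs_le]; constructor <;> nlinarith [hu.2]
        _ = (G x1 + t * a) / e^2 * e^2 := by field_simp
        _ ≤ (G x1 + t * a) / e^2 * u^2 := by gcongr
        _ ≤ _ := by gcongr; exact le_max_right _ _

lemma aux_conn (a : ℝ) (ha : 0 < a) :
    IsPreconnected {z : ℂ | ¬(z.im = 0 ∧ -a ≤ z.re ∧ z.re ≤ 0)} := by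
  have h1 : IsPreconnected {z : ℂ | 0 < z.im} := (convex_halfSpace_im_gt 0).isPreconnected
  have h2 : IsPreconnected {z : ℂ | z.im < 0} := (convex_halfSpace_im_lt 0).isPreconnected
  have h3 : IsPreconnected {z : ℂ | 0 < z.re} := (convex_halfSpace_re_gt 0).isPreconnected
  have h4 : IsPreconnected {z : ℂ | z.re < -a} := (convex_halfSpace_re_lt (-a)).isPreconnected
  have h13 := IsPreconnected.union (⟨1, 1⟩ : ℂ) (by simp) (by simp) h1 h3
  have h134 := IsPreconnected.union (⟨-a-1, 1⟩ : ℂ) (by simp) (by simp) h13 h4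
  have h := IsPreconnected.union (⟨1, -1⟩ : ℂ) (by simp) (by simp) h134 h2
  convert h using 1
  ext z
  simp only [Set.mem_ofPred_eq, Set.mem_union]
  grind

lemma aux_open (a : ℝ) :
    IsOpen {z : ℂ | ¬(z.im = 0 ∧ -a ≤ z.re ∧ z.re ≤ 0)} := by
  have : IsClosed {z : ℂ | z.im = 0 ∧ -a ≤ z.re ∧ z.re ≤ 0} :=
    (isClosed_eq Complex.continuous_im continuous_const).inter
      ((isClosed_le continuous_const Complex.continuous_re).inter
       (isClosed_le Complex.continuous_re continuous_const))
  exact this.isOpen_compl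

lemma aux_rpow_half (x : ℝ) (hx : 0 < x) : x ^ (-(1:ℝ)/2) = (Real.sqrt x)⁻¹ := by
  rw [Real.sqrt_eq_rpow, ← Real.rpow_neg hx.le]; norm_num

lemma aux_L_le (s s0 y : ℝ) (hs : -s0 ≤ s) :
    Real.log (1 + Real.exp (-s - y)) ≤ Real.exp s0 * Real.exp (-y) := by
  refine (aux_log_le _).trans ?_
  rw [← Real.exp_add]
  exact Real.exp_le_exp.2 (by linarith)

lemma aux_F0_int (s s0 k : ℝ) (hs : -s0 ≤ s) (hk : 0 < k) :
    IntegrableOn (fun u : ℝ => Real.log (1 + Real.exp (-s - k * u)) * (Real.sqrt u)⁻¹)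
      (Set.Ioi 0) := by
  have h := (integrableOn_rpow_mul_exp_neg_mul_rpow (s := -(1:ℝ)/2) (p := 1) (b := k)
    (by norm_num) (by norm_num) hk).const_mul (Real.exp s0)
  refine Integrable.mono' h ?_ ?_
  · apply Measurable.aestronglyMeasurable
    fun_prop
  · refine (ae_restrict_mem measurableSet_Ioi).mono ?_
    intro u hu
    have hu0 : 0 < u := hu
    rw [Real.norm_of_nonneg (mul_nonneg (aux_log_nonneg _) (by positivity)), aux_rpow_half u hu0,
      Real.rpow_one, mul_comm (Real.sqrt u)⁻¹, ← mul_assoc]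
    gcongr
    simpa using aux_L_le s s0 (k * u) hs

lemma aux_F_scale (s k : ℝ) (hk : 0 < k) :
    ∫ u in Set.Ioi (0:ℝ), Real.log (1 + Real.exp (-s - k * u)) * (Real.sqrt u)⁻¹
     = (Real.sqrt k)⁻¹ * ∫ v in Set.Ioi (0 : ℝ), v ^ (-(1:ℝ)/2) * Real.log (1 + Real.exp (-s - v)) := by
  have h := integral_comp_mul_left_Ioi (fun v : ℝ => v ^ (-(1:ℝ)/2) * Real.log (1 + Real.exp (-s - v))) 0 hk
  rw [mul_zero, smul_eq_mul] at h
  have h2 : ∫ u in Set.Ioi (0:ℝ), (k * u) ^ (-(1:ℝ)/2) * Real.log (1 + Real.exp (-s - k * u))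
     = (Real.sqrt k)⁻¹ * ∫ u in Set.Ioi (0:ℝ), Real.log (1 + Real.exp (-s - k * u)) * (Real.sqrt u)⁻¹ := by
    rw [← integral_const_mul]
    apply setIntegral_congr_fun measurableSet_Ioi
    intro u hu
    have hu0 : 0 < u := hu
    simp only
    rw [aux_rpow_half _ (by positivity), Real.sqrt_mul hk.le, mul_inv]
    ring
  rw [h2] at h
  have hsk := Real.sqrt_pos.2 hk
  have hkk : k⁻¹ = (Real.sqrt k)⁻¹ * (Real.sqrt k)⁻¹ := by
    rw [← mul_inv, Real.mul_self_sqrt hk.le]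
  rw [hkk, mul_assoc] at h
  exact mul_left_cancel₀ (by positivity) h

lemma aux_tail (a : ℝ) (ha : 0 < a) :
    IntegrableOn (fun u : ℝ => u ^ (-(3:ℝ)/2)) (Set.Ioi a) :=
  integrableOn_Ioi_rpow_of_lt (by norm_num) ha

/-- pointwise bound -/
lemma aux_pt (a t c M d s0 : ℝ) (ha : 0 < a) (ht : 0 < t) (hc : 0 < c) (hct : c ≤ t) (hM : 0 < M)
    (hd : 0 < d) (g N s u : ℝ) (hN : 0 < N) (hs : -s0 ≤ s) (hu : 0 < u) (hua : u < a)
    (hg : c * u ≤ g) (hg2 : |g - t * u| ≤ M * u ^ 2)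
    (z : ℂ) (hz : d ≤ ‖z‖) (hzu : d ≤ ‖z + u‖) :
    ‖((Real.log (1 + Real.exp (-s - N * g)) / Real.sqrt (u * (a - u)) : ℝ) : ℂ) / (z + u)
      - ((Real.log (1 + Real.exp (-s - N * t * u)) * (Real.sqrt u)⁻¹ : ℝ) : ℂ) / (Real.sqrt a * z)‖
    ≤ (M * Real.exp s0 * 2 / c ^ 2 / d + Real.exp s0 / t * (1 / d ^ 2 + 1 / (a * d))) / N *
        (Real.sqrt (u * (a - u)))⁻¹ := by
  have hv : 0 < a - u := by linarith
  set w := (Real.sqrt (u * (a - u)))⁻¹ with hw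
  have hwpos : 0 < w := by positivity
  set L := Real.log (1 + Real.exp (-s - N * g)) with hL
  set L0 := Real.log (1 + Real.exp (-s - N * t * u)) with hL0
  have hL0n : 0 ≤ L0 := aux_log_nonneg _
  have hdiff : |L - L0| ≤ M * Real.exp s0 * 2 / c ^ 2 / N := by
    have h1 := aux_log_diff (s + N * g) (s + N * t * u) (-s0 + N * c * u)
      (by nlinarith) (by have : N * c * u ≤ N * t * u := by gcongr
                         linarith)
    rw [show -(s + N * g) = -s - N * g by ring, show -(s + N * t * u) = -s - N * t * u by ring,
      show s + N * g - (s + N * t * u) = N * (g - t * u) by ring, abs_mul, abs_of_pos hN,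
      show -(-s0 + N * c * u) = s0 + -(N * c * u) by ring, Real.exp_add] at h1
    have h2 := aux_exp2 (N * c * u) (by positivity)
    calc |L - L0| ≤ N * |g - t * u| * (Real.exp s0 * Real.exp (-(N * c * u))) := h1
      _ ≤ N * (M * u ^ 2) * (Real.exp s0 * Real.exp (-(N * c * u))) := by gcongr
      _ = M * Real.exp s0 * ((N * c * u) ^ 2 * Real.exp (-(N * c * u))) / c ^ 2 / N := by
          field_simp
      _ ≤ _ := by gcongr
  have hL0le : L0 * u ≤ Real.exp s0 / t / N := by
    have h1 := aux_L_le s s0 (N * t * u) hs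
    have h2 := aux_exp1 (N * t * u) (by positivity)
    calc L0 * u ≤ Real.exp s0 * (1 / (N * t * u)) * u := by
          gcongr; exact h1.trans (by gcongr)
      _ = _ := by field_simp
  have hz0 : z ≠ 0 := by rw [← norm_pos_iff]; linarith
  have hzu0 : z + u ≠ 0 := by rw [← norm_pos_iff]; linarith
  have hsa := Real.sqrt_pos.2 ha
  have hsu := Real.sqrt_pos.2 hu
  have hsv := Real.sqrt_pos.2 hv
  set w1 := (Real.sqrt u)⁻¹ / Real.sqrt a with hw1
  have hww : |w - w1| ≤ w * u / a := by
    have e1 : w1 = w * Real.sqrt ((a - u) / a) := by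
      rw [hw, hw1, Real.sqrt_mul hu.le, Real.sqrt_div hv.le]; field_simp
    have e2 : (a - u) / a ≤ Real.sqrt ((a - u) / a) := by
      apply Real.le_sqrt_of_sq_le
      have h0 : 0 ≤ (a-u)/a := by positivity
      have h1 : (a - u) / a ≤ 1 := by rw [div_le_one ha]; linarith
      nlinarith
    have e3 : Real.sqrt ((a - u) / a) ≤ 1 := by
      apply Real.sqrt_le_one.2
      rw [div_le_one ha]; linarith
    have e4 : (a - u) / a = 1 - u / a := by field_simp
    rw [e1, show w - w * Real.sqrt ((a-u)/a) = w * (1 - Real.sqrt ((a-u)/a)) by ring, abs_mul,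
      abs_of_pos hwpos, abs_of_nonneg (by linarith), mul_div_assoc]
    gcongr
    linarith
  have key : ((L / Real.sqrt (u * (a - u)) : ℝ) : ℂ) / (z + u)
      - ((L0 * (Real.sqrt u)⁻¹ : ℝ) : ℂ) / (Real.sqrt a * z)
      = (((L - L0) * w : ℝ) : ℂ) / (z + u) + ((-(L0 * u) * w : ℝ) : ℂ) / (z * (z + u))
        + ((L0 * (w - w1) : ℝ) : ℂ) / z := by
    have ew : L / Real.sqrt (u * (a - u)) = L * w := by rw [hw]; rfl
    have ew1 : (Real.sqrt u)⁻¹ = w1 * Real.sqrt a := by rw [hw1]; field_simp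
    have hsa' : ((Real.sqrt a : ℝ) : ℂ) ≠ 0 := by exact_mod_cast hsa.ne'
    rw [ew, ew1]
    push_cast
    field_simp
    ring
  rw [key]
  have b1 : ‖(((L - L0) * w : ℝ) : ℂ) / (z + u)‖ ≤ M * Real.exp s0 * 2 / c ^ 2 / N * w / d := by
    rw [norm_div, Complex.norm_real, Real.norm_eq_abs, abs_mul, abs_of_pos hwpos]
    gcongr
  have b2 : ‖((-(L0 * u) * w : ℝ) : ℂ) / (z * (z + u))‖ ≤ Real.exp s0 / t / N * w / (d * d) := by
    rw [norm_div, Complex.norm_real, Real.norm_eq_abs, abs_mul, abs_of_pos hwpos, abs_neg,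
      abs_of_nonneg (by positivity), norm_mul]
    gcongr
  have b3 : ‖((L0 * (w - w1) : ℝ) : ℂ) / z‖ ≤ Real.exp s0 / t / N * w / a / d := by
    rw [norm_div, Complex.norm_real, Real.norm_eq_abs, abs_mul, abs_of_nonneg hL0n]
    have : L0 * |w - w1| ≤ Real.exp s0 / t / N * w / a := by
      calc L0 * |w - w1| ≤ L0 * (w * u / a) := by gcongr
        _ = L0 * u * w / a := by ring
        _ ≤ _ := by gcongr
    gcongr
  calc _ ≤ _ := norm_add₃_le
    _ ≤ _ := add_le_add (add_le_add b1 b2) b3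
    _ = _ := by field_simp; ring

lemma aux_I_int (a : ℝ) (ha : 0 < a) (d s0 : ℝ) (hd : 0 < d) (G : ℝ → ℝ)
    (hGc : ContinuousOn G (Set.Ioo 0 a)) (hG0 : ∀ u ∈ Set.Ioo 0 a, 0 ≤ G u) (N s : ℝ) (hN : 0 < N)
    (hs : -s0 ≤ s) :
    IntegrableOn (fun u : ℝ => Real.log (1 + Real.exp (-s - N * G u)) / Real.sqrt (u * (a - u)))
      (Set.Ioo 0 a) := by
  refine Integrable.mono' ((aux_w_int a ha).const_mul (Real.exp s0)) ?_ ?_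
  · apply ContinuousOn.aestronglyMeasurable _ measurableSet_Ioo
    apply ContinuousOn.div
    · apply ContinuousOn.log
      · fun_prop
      · intro x hx; positivity
    · fun_prop
    · intro u hu
      have : 0 < a - u := by linarith [hu.2]
      have := hu.1
      positivity
  · refine (ae_restrict_mem measurableSet_Ioo).mono ?_
    intro u hu
    rw [Real.norm_of_nonneg (div_nonneg (aux_log_nonneg _) (by positivity)), div_eq_mul_inv]
    gcongr
    refine (aux_L_le s s0 _ hs).trans ?_
    apply mul_le_of_le_one_right (by positivity)
    rw [Real.exp_le_one_iff]
    have := hG0 u hu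
    nlinarith

lemma aux_core (a t c M d s0 : ℝ) (ha : 0 < a) (ht : 0 < t) (hc : 0 < c) (hct : c ≤ t) (hM : 0 < M)
    (hd : 0 < d) (G : ℝ → ℝ) (hGc : ContinuousOn G (Set.Ioo 0 a))
    (hG : ∀ u ∈ Set.Ioo 0 a, c * u ≤ G u ∧ |G u - t * u| ≤ M * u ^ 2) :
    ∃ C > 0, ∀ N s : ℝ, 0 < N → -s0 ≤ s → ∀ z : ℂ, (∀ u ∈ Set.Icc 0 a, d ≤ ‖z + (u:ℂ)‖) →
    ‖(∫ u in Set.Ioo 0 a, ((Real.log (1 + Real.exp (-s - N * G u)) / Real.sqrt (u * (a - u)) : ℝ) : ℂ)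
        / (z + u))
      - (((Real.sqrt (N * t))⁻¹ * ∫ v in Set.Ioi (0 : ℝ), v ^ (-(1:ℝ)/2) * Real.log (1 + Real.exp (-s - v)) : ℝ) : ℂ) / (Real.sqrt a * z)‖ ≤ C / N := by
  set D := (M * Real.exp s0 * 2 / c ^ 2 / d + Real.exp s0 / t * (1 / d ^ 2 + 1 / (a * d))) with hD
  have hDpos : 0 < D := by positivity
  set W := ∫ u in Set.Ioo 0 a, (Real.sqrt (u * (a - u)))⁻¹ with hW
  have hWn : 0 ≤ W := integral_nonneg (fun u => by positivity)
  set T := ∫ u in Set.Ioi a, u ^ (-(3:ℝ)/2) with hT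
  have hTn : 0 ≤ T := setIntegral_nonneg measurableSet_Ioi
    (fun u hu => Real.rpow_nonneg (ha.le.trans (le_of_lt hu)) _)
  have hsa := Real.sqrt_pos.2 ha
  set E := Real.exp s0 / t / (Real.sqrt a * d) with hE
  have hEpos : 0 < E := by positivity
  refine ⟨D * W + E * T + 1, by positivity, ?_⟩
  intro N s hN hs z hz
  have hz1 : d ≤ ‖z‖ := by simpa using hz 0 ⟨le_rfl, ha.le⟩
  have hF0 := aux_F0_int s s0 (N * t) hs (by positivity)
  have hF0c : IntegrableOn (fun u : ℝ => ((Real.log (1 + Real.exp (-s - N * t * u)) * (Real.sqrt u)⁻¹ : ℝ) : ℂ) / (Real.sqrt a * z)) (Set.Ioi 0) :=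
    (Integrable.ofReal hF0).div_const _
  have hIr := aux_I_int a ha d s0 hd G hGc (fun u hu => by
    have := (hG u hu).1
    have := hu.1
    nlinarith) N s hN hs
  have hI : IntegrableOn (fun u : ℝ => ((Real.log (1 + Real.exp (-s - N * G u)) / Real.sqrt (u * (a - u)) : ℝ) : ℂ)
        / (z + u)) (Set.Ioo 0 a) := by
    have := (Integrable.ofReal (𝕜 := ℂ) hIr).mul_bdd (g := fun u : ℝ => ((z + u)⁻¹ : ℂ)) (c := d⁻¹) ?_ ?_
    · exact this.congr (Filter.Eventually.of_forall fun u => (div_eq_mul_inv _ _).symm)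
    · apply Measurable.aestronglyMeasurable
      fun_prop
    · refine (ae_restrict_mem measurableSet_Ioo).mono ?_
      intro u hu
      rw [norm_inv]
      have := hz u ⟨hu.1.le, hu.2.le⟩
      gcongr
  rw [← aux_F_scale s (N * t) (by positivity), ← integral_complex_ofReal, ← integral_div]
  have hsplit : Set.Ioi (0:ℝ) = Set.Ioc 0 a ∪ Set.Ioi a := (Set.Ioc_union_Ioi_eq_Ioi ha.le).symm
  rw [hsplit, setIntegral_union (Set.Ioc_disjoint_Ioi le_rfl) measurableSet_Ioi
    (hF0c.mono_set Set.Ioc_subset_Ioi_self) (hF0c.mono_set (Set.Ioi_subset_Ioi ha.le)),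
    integral_Ioc_eq_integral_Ioo, ← sub_sub,
    ← integral_sub hI (hF0c.mono_set Set.Ioo_subset_Ioi_self)]
  have hA := norm_integral_le_of_norm_le (μ := volume.restrict (Set.Ioo 0 a)) ((aux_w_int a ha).const_mul (D / N))
    ((ae_restrict_mem measurableSet_Ioo).mono (fun u hu =>
      aux_pt a t c M d s0 ha ht hc hct hM hd (G u) N s u hN hs hu.1 hu.2 (hG u hu).1 (hG u hu).2 z hz1
        (hz u ⟨hu.1.le, hu.2.le⟩)))
  have hB := norm_integral_le_of_norm_le (μ := volume.restrict (Set.Ioi a))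
    (f := fun u : ℝ => ((Real.log (1 + Real.exp (-s - N * t * u)) * (Real.sqrt u)⁻¹ : ℝ) : ℂ) / (Real.sqrt a * z))
    ((aux_tail a ha).const_mul (E / N))
    ((ae_restrict_mem measurableSet_Ioi).mono (fun u hu => by
      have hu0 : 0 < u := ha.trans hu
      have hsu := Real.sqrt_pos.2 hu0
      have e : u ^ (-(3:ℝ)/2) = u⁻¹ * (Real.sqrt u)⁻¹ := by
        rw [← aux_rpow_half u hu0, ← Real.rpow_neg_one, ← Real.rpow_add hu0]; norm_num
      have h1 := aux_L_le s s0 (N * t * u) hs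
      have h2 := aux_exp1 (N * t * u) (by positivity)
      rw [norm_div, Complex.norm_real, Real.norm_of_nonneg (mul_nonneg (aux_log_nonneg _) (by positivity)),
        norm_mul, Complex.norm_real, Real.norm_of_nonneg hsa.le, e]
      calc _ ≤ Real.exp s0 * (1 / (N * t * u)) * (Real.sqrt u)⁻¹ / (Real.sqrt a * d) := by
            gcongr
            exact h1.trans (by gcongr)
        _ = _ := by rw [hE]; field_simp))
  rw [integral_const_mul] at hA hB
  calc _ ≤ _ := norm_sub_le _ _
    _ ≤ D / N * W + E / N * T := add_le_add hA hB
    _ = (D * W + E * T) / N := by ring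
    _ ≤ _ := by exact div_le_div_of_nonneg_right (by linarith) hN.le

lemma aux_dist (a : ℝ) (K : Set ℂ) (hK : IsCompact K)
    (hKS : K ⊆ {z : ℂ | ¬(z.im = 0 ∧ -a ≤ z.re ∧ z.re ≤ 0)}) :
    ∃ d > 0, ∀ z ∈ K, ∀ u ∈ Set.Icc 0 a, d ≤ ‖z + (u:ℂ)‖ := by
  have hc : IsCompact (K ×ˢ (Set.Icc 0 a)) := hK.prod isCompact_Icc
  obtain ⟨d, hd, h⟩ := hc.exists_forall_le' (f := fun p : ℂ × ℝ => ‖p.1 + (p.2:ℂ)‖) (a := 0)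
    (by fun_prop) (by
      rintro ⟨z, u⟩ ⟨hz, hu⟩
      simp only [norm_pos_iff]
      intro h0
      apply hKS hz
      have hz' : z = -(u:ℂ) := eq_neg_of_add_eq_zero_left h0
      simp only at hu
      rw [hz']
      simp
      exact ⟨hu.2, hu.1⟩)
  exact ⟨d, hd, fun z hz u hu => h (z, u) ⟨hz, hu⟩⟩

lemma aux_diff (a : ℝ) (h : ℝ → ℝ) (hh : IntegrableOn h (Set.Ioo 0 a)) (z0 : ℂ)
    (hz0 : z0 ∈ {z : ℂ | ¬(z.im = 0 ∧ -a ≤ z.re ∧ z.re ≤ 0)}) :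
    DifferentiableAt ℂ (fun z => ∫ u in Set.Ioo 0 a, (h u : ℂ) / (z + u)) z0 := by
  obtain ⟨d, hd, hdist⟩ := aux_dist a {z0} isCompact_singleton (by simpa using hz0)
  have hdist : ∀ u ∈ Set.Icc 0 a, d ≤ ‖z0 + (u:ℂ)‖ := hdist z0 rfl
  have hb : ∀ z ∈ Metric.ball z0 (d/2), ∀ u ∈ Set.Icc 0 a, d / 2 ≤ ‖z + (u:ℂ)‖ := by
    intro z hz u hu
    have h1 := hdist u hu
    rw [Metric.mem_ball, dist_comm, dist_eq_norm] at hz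
    have h2 : ‖z0 + (u:ℂ)‖ ≤ ‖z0 - z‖ + ‖z + u‖ := by
      calc _ = ‖(z0 - z) + (z + u)‖ := by congr 1; ring
        _ ≤ _ := norm_add_le _ _
    linarith
  have hm : ∀ z : ℂ, AEStronglyMeasurable (fun u : ℝ => (h u : ℂ) / (z + u)) (volume.restrict (Set.Ioo 0 a)) := by
    intro z
    have h1 : AEStronglyMeasurable (fun u : ℝ => (h u : ℂ)) (volume.restrict (Set.Ioo 0 a)) := (Integrable.ofReal hh).aestronglyMeasurable
    have h2 : AEStronglyMeasurable (fun u : ℝ => ((z + u)⁻¹ : ℂ)) (volume.restrict (Set.Ioo 0 a)) := by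
      apply Measurable.aestronglyMeasurable
      fun_prop
    exact (h1.mul h2).congr (Filter.Eventually.of_forall fun u => (div_eq_mul_inv _ _).symm)
  have hm2 : AEStronglyMeasurable (fun u : ℝ => -(h u : ℂ) / (z0 + u)^2) (volume.restrict (Set.Ioo 0 a)) := by
    have h1 := hm z0
    have h2 : AEStronglyMeasurable (fun u : ℝ => (-(z0 + u)⁻¹ : ℂ)) (volume.restrict (Set.Ioo 0 a)) := by
      apply Measurable.aestronglyMeasurable
      fun_prop
    have h3 := h1.mul h2
    refine h3.congr (Filter.Eventually.of_forall fun u => ?_)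
    simp only [Pi.mul_apply, div_eq_mul_inv]
    rw [← inv_pow]; ring
  have := hasDerivAt_integral_of_dominated_loc_of_deriv_le (𝕜 := ℂ) (μ := volume.restrict (Set.Ioo 0 a))
    (F := fun (z : ℂ) (u : ℝ) => (h u : ℂ) / (z + u)) (F' := fun (z : ℂ) (u : ℝ) => -(h u : ℂ) / (z + u)^2)
    (x₀ := z0) (s := Metric.ball z0 (d/2)) (bound := fun u => |h u| / (d/2)^2)
    (Metric.ball_mem_nhds _ (by positivity)) (Filter.Eventually.of_forall hm) ?_ hm2 ?_ ?_ ?_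
  · exact this.2.differentiableAt
  · refine Integrable.mono' (hh.norm.div_const d) (hm z0) ?_
    refine (ae_restrict_mem measurableSet_Ioo).mono ?_
    intro u hu
    rw [norm_div, Complex.norm_real]
    have := hdist u ⟨hu.1.le, hu.2.le⟩
    gcongr
  · refine (ae_restrict_mem measurableSet_Ioo).mono ?_
    intro u hu z hz
    rw [norm_div, norm_neg, Complex.norm_real, norm_pow, Real.norm_eq_abs]
    have := hb z hz u ⟨hu.1.le, hu.2.le⟩
    gcongr
  · exact hh.abs.div_const _
  · refine (ae_restrict_mem measurableSet_Ioo).mono ?_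
    intro u hu z hz
    have h1 := hb z hz u ⟨hu.1.le, hu.2.le⟩
    have h0 : z + u ≠ 0 := by rw [← norm_pos_iff]; linarith
    have h2 := (((hasDerivAt_id z).add_const (u:ℂ)).inv h0).const_mul (h u : ℂ)
    refine (h2.congr_deriv ?_).congr_of_eventuallyEq ?_
    · simp; ring
    · exact Filter.Eventually.of_forall fun y => by simp [div_eq_mul_inv]

lemma aux_subst (a : ℝ) (ha : 0 < a) (f : ℝ → ℂ) :
    ∫ x in Set.Ioo (-a) (0 : ℝ), f x = ∫ u in Set.Ioo 0 a, f (-u) := by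
  rw [← integral_Ioc_eq_integral_Ioo, ← integral_Ioc_eq_integral_Ioo,
    ← intervalIntegral.integral_of_le (by linarith), ← intervalIntegral.integral_of_le ha.le,
    intervalIntegral.integral_comp_neg, neg_zero]

lemma aux_r (a : ℝ) (ha : 0 < a)
    (S : Set ℂ) (hS : S = {z : ℂ | ¬(z.im = 0 ∧ -a ≤ z.re ∧ z.re ≤ 0)})
    (r : ℂ → ℂ)
    (hr_an : DifferentiableOn ℂ r S)
    (hr_sq : ∀ z ∈ S, (r z) ^ 2 = (z + Complex.ofReal a) * z)
    (hr_pos : ∀ x : ℝ, 0 < x → (r (Complex.ofReal x)).im = 0 ∧ 0 < (r (Complex.ofReal x)).re)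
    (msq : ℂ → ℂ)
    (hmsq_an : DifferentiableOn ℂ msq S)
    (hmsq_sq : ∀ z ∈ S, (msq z) ^ 2 = z / (z + Complex.ofReal a))
    (hmsq_pos : ∀ x : ℝ, 0 < x →
      (msq (Complex.ofReal x)).im = 0 ∧ 0 < (msq (Complex.ofReal x)).re) :
    ∀ z ∈ S, z ≠ 0 ∧ msq z ≠ 0 ∧ r z / z = 1 / msq z := by
  have hz0 : ∀ z ∈ S, z ≠ 0 := by
    rintro z hz rfl
    rw [hS] at hz
    exact hz (by simp [ha.le])
  have hza : ∀ z ∈ S, z + (a:ℂ) ≠ 0 := by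
    intro z hz h
    have : z = -(a:ℂ) := eq_neg_of_add_eq_zero_left h
    rw [hS, this] at hz
    exact hz (by simp [ha.le])
  have hpre : IsPreconnected S := by rw [hS]; exact aux_conn a ha
  have h1S : (1:ℂ) ∈ S := by rw [hS]; simp
  have heq : Set.EqOn (fun z => r z * msq z) (fun z => z) S := by
    refine hpre.eq_of_sq_eq (hr_an.continuousOn.mul hmsq_an.continuousOn) continuousOn_id ?_
      (fun {z} hz => hz0 z hz) h1S ?_
    · intro z hz
      have := hza z hz
      simp only [Pi.pow_apply, mul_pow, hr_sq z hz, hmsq_sq z hz]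
      field_simp
    · have a1 := hr_pos 1 one_pos
      have a2 := hmsq_pos 1 one_pos
      have b1 := hr_sq 1 h1S
      have b2 := hmsq_sq 1 h1S
      rw [Complex.ofReal_one] at a1 a2
      have c : (r 1 * msq 1) ^ 2 = 1 := by
        have := hza 1 h1S
        rw [mul_pow, b1, b2]; field_simp
      rcases (sq_eq_sq_iff_eq_or_eq_neg.1 (c.trans (one_pow 2).symm)) with h | h
      · exact h
      · exfalso
        have := congrArg Complex.re h
        simp [a1.1, a2.1] at this
        nlinarith [mul_pos a1.2 a2.2]
  intro z hz
  have h := heq hz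
  simp only at h
  have h0 := hz0 z hz
  have hm : msq z ≠ 0 := by
    intro hm; rw [hm, mul_zero] at h; exact h0 h.symm
  refine ⟨h0, hm, ?_⟩
  rw [div_eq_div_iff h0 hm, one_mul]; exact h

lemma aux_F_bdd (s0 : ℝ) : ∃ B > 0, ∀ s, -s0 ≤ s →
    |∫ v in Set.Ioi (0 : ℝ), v ^ (-(1:ℝ)/2) * Real.log (1 + Real.exp (-s - v))| ≤ B := by
  have h := (integrableOn_rpow_mul_exp_neg_mul_rpow (s := -(1:ℝ)/2) (p := 1) (b := 1)
    (by norm_num) (by norm_num) one_pos).const_mul (Real.exp s0)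
  refine ⟨|∫ v in Set.Ioi (0 : ℝ), Real.exp s0 * (v ^ (-(1:ℝ)/2) * Real.exp (-1 * v ^ (1:ℝ)))| + 1,
    by positivity, ?_⟩
  intro s hs
  rw [← Real.norm_eq_abs]
  refine (norm_integral_le_of_norm_le h ?_).trans ((le_abs_self _).trans (by linarith))
  refine (ae_restrict_mem measurableSet_Ioi).mono ?_
  intro v hv
  have hv0 : 0 < v := hv
  rw [Real.norm_of_nonneg (mul_nonneg (by positivity) (aux_log_nonneg _)), Real.rpow_one]
  have := aux_L_le s s0 v hs
  calc _ ≤ v ^ (-(1:ℝ)/2) * (Real.exp s0 * Real.exp (-v)) := by gcongr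
    _ = _ := by rw [neg_one_mul]; ring

/-- asymptotics of the Szegő-type function `q_n(z|s)` and its derivative,
uniformly on compact subsets of `ℂ ∖ [-a,0]` and for `s ≥ -s₀`. -/
theorem stmt_9
    (a t : ℝ) (ha : 0 < a) (ht : 0 < t)
    (Q : ℝ → ℝ)
    (hQcont : ContinuousOn Q (Set.Icc (-a) 0))
    (hQpos : ∀ x ∈ Set.Ico (-a) (0 : ℝ), 0 < Q x)
    (hQ0 : Q 0 = 0)
    (hQsm : ∃ U : Set ℝ, IsOpen U ∧ (0 : ℝ) ∈ U ∧ ContDiffOn ℝ (⊤ : ℕ∞) Q U)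
    (hQder : deriv Q 0 = -t)
    (S : Set ℂ) (hS : S = {z : ℂ | ¬(z.im = 0 ∧ -a ≤ z.re ∧ z.re ≤ 0)})
    (r : ℂ → ℂ)
    (hr_an : DifferentiableOn ℂ r S)
    (hr_sq : ∀ z ∈ S, (r z) ^ 2 = (z + Complex.ofReal a) * z)
    (hr_pos : ∀ x : ℝ, 0 < x → (r (Complex.ofReal x)).im = 0 ∧ 0 < (r (Complex.ofReal x)).re)
    (msq : ℂ → ℂ)
    (hmsq_an : DifferentiableOn ℂ msq S)
    (hmsq_sq : ∀ z ∈ S, (msq z) ^ 2 = z / (z + Complex.ofReal a))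
    (hmsq_pos : ∀ x : ℝ, 0 < x →
      (msq (Complex.ofReal x)).im = 0 ∧ 0 < (msq (Complex.ofReal x)).re)
    (q : ℕ → ℝ → ℂ → ℂ)
    (hq : ∀ (n : ℕ) (s : ℝ) (z : ℂ), q n s z =
      r z / (2 * Real.pi) *
        ∫ x in Set.Ioo (-a) (0 : ℝ),
          Complex.ofReal
              (Real.log ((1 + Real.exp (-s - (n : ℝ) ^ ((2 : ℝ) / 3) * Q x))⁻¹) /
                Real.sqrt (|x| * (x + a))) /
            (Complex.ofReal x - z))
    (F : ℝ → ℝ → ℝ)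
    (hF : ∀ β y, F β y = ∫ v in Set.Ioi (0 : ℝ), v ^ β * Real.log (1 + Real.exp (-y - v)))
    (s0 : ℝ) (hs0 : 0 < s0)
    (Kc : Set ℂ) (hKc : IsCompact Kc) (hKcS : Kc ⊆ S) :
    ∃ C > 0, ∃ n0 : ℕ, 1 ≤ n0 ∧
      ∀ n : ℕ, n0 ≤ n → ∀ s : ℝ, -s0 ≤ s → ∀ z ∈ Kc,
        ‖q n s z - Complex.ofReal ((n : ℝ) ^ (-(1 : ℝ) / 3)) *
            (Complex.ofReal (F (-(1 : ℝ) / 2) s) /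
              (Complex.ofReal (2 * Real.pi * Real.sqrt a * Real.sqrt t) * msq z))‖
          ≤ C * (n : ℝ) ^ (-(2 : ℝ) / 3) ∧
        ‖deriv (q n s) z‖ ≤ C * (n : ℝ) ^ (-(1 : ℝ) / 3) := by
  have hSo : IsOpen S := by rw [hS]; exact aux_open a
  have hrm := aux_r a ha S hS r hr_an hr_sq hr_pos msq hmsq_an hmsq_sq hmsq_pos
  obtain ⟨c, hc, hct, M, hM, hQb⟩ := aux_Q a t ha ht Q hQcont hQpos hQ0 hQsm hQder
  have hGc : ContinuousOn (fun u => Q (-u)) (Set.Ioo 0 a) := by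
    apply hQcont.comp continuous_neg.continuousOn
    intro x hx
    simp at hx ⊢
    constructor <;> linarith [hx.1, hx.2]
  obtain ⟨B, hB, hFB⟩ := aux_F_bdd s0
  have hq' : ∀ (n : ℕ) (s : ℝ) (z : ℂ), q n s z = r z / (2 * Real.pi) *
      ∫ u in Set.Ioo 0 a, ((Real.log (1 + Real.exp (-s - (n:ℝ) ^ ((2:ℝ)/3) * Q (-u))) / Real.sqrt (u * (a - u)) : ℝ) : ℂ) / (z + u) := by
    intro n s z
    rw [hq, aux_subst a ha]
    congr 1
    apply setIntegral_congr_fun measurableSet_Ioo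
    intro u hu
    simp only
    rw [abs_neg, abs_of_pos hu.1, Real.log_inv, neg_div, show -u + a = a - u by ring,
      Complex.ofReal_neg, Complex.ofReal_neg, show -(u:ℂ) - z = -(z + u) by ring, neg_div_neg_eq]
  have hsa := Real.sqrt_pos.2 ha
  have hst := Real.sqrt_pos.2 ht
  have hmain : ∀ K : Set ℂ, IsCompact K → K ⊆ S → ∃ C > 0, ∀ n : ℕ, 1 ≤ n → ∀ s : ℝ, -s0 ≤ s →
      ∀ z ∈ K, ‖q n s z - Complex.ofReal ((n : ℝ) ^ (-(1 : ℝ) / 3)) *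
            (Complex.ofReal (F (-(1 : ℝ) / 2) s) /
              (Complex.ofReal (2 * Real.pi * Real.sqrt a * Real.sqrt t) * msq z))‖
          ≤ C * (n : ℝ) ^ (-(2 : ℝ) / 3) ∧ ‖q n s z‖ ≤ C * (n : ℝ) ^ (-(1 : ℝ) / 3) := by
    intro K hK hKS
    obtain ⟨d, hd, hdist⟩ := aux_dist a K hK (hS ▸ hKS)
    obtain ⟨C, hC, hcore⟩ := aux_core a t c M d s0 ha ht hc hct hM hd _ hGc hQb
    obtain ⟨R, hR⟩ := hK.exists_bound_of_continuousOn (hr_an.continuousOn.mono hKS)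
    set R1 := max R 1
    have hR1 : 0 < R1 := by positivity
    have hpi := Real.pi_pos
    set C1 := R1 / (2 * Real.pi) * C with hC1
    set C2 := R1 / (2 * Real.pi) * (B / (Real.sqrt a * Real.sqrt t * d)) with hC2
    have hC1p : 0 < C1 := by positivity
    have hC2p : 0 < C2 := by positivity
    refine ⟨C1 + C2, by positivity, ?_⟩
    intro n hn s hs z hz
    have hn1 : (1:ℝ) ≤ n := by exact_mod_cast hn
    have hn0 : (0:ℝ) < n := by linarith
    obtain ⟨hz0, hm0, hrz⟩ := hrm z (hKS hz)
    have hdz : d ≤ ‖z‖ := by simpa using hdist z hz 0 ⟨le_rfl, ha.le⟩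
    have hRz : ‖r z‖ ≤ R1 := (hR z hz).trans (le_max_left _ _)
    have h := hcore ((n:ℝ) ^ ((2:ℝ)/3)) s (by positivity) hs z (hdist z hz)
    rw [← hF] at h
    have eN : (Real.sqrt ((n:ℝ) ^ ((2:ℝ)/3) * t))⁻¹ = (n:ℝ) ^ (-(1:ℝ)/3) * (Real.sqrt t)⁻¹ := by
      rw [Real.sqrt_mul (by positivity), mul_inv, Real.sqrt_eq_rpow, ← Real.rpow_mul hn0.le,
        ← Real.rpow_neg hn0.le]
      norm_num
    have eD : C / (n:ℝ) ^ ((2:ℝ)/3) = C * (n:ℝ) ^ (-(2:ℝ)/3) := by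
      rw [div_eq_mul_inv, ← Real.rpow_neg hn0.le]; norm_num
    rw [eN, eD] at h
    have eT : Complex.ofReal ((n : ℝ) ^ (-(1 : ℝ) / 3)) *
            (Complex.ofReal (F (-(1 : ℝ) / 2) s) /
              (Complex.ofReal (2 * Real.pi * Real.sqrt a * Real.sqrt t) * msq z))
        = r z / (2 * Real.pi) * ((((n:ℝ) ^ (-(1:ℝ)/3) * (Real.sqrt t)⁻¹ * F (-(1:ℝ)/2) s : ℝ) : ℂ) / (Real.sqrt a * z)) := by
      have hsa' : ((Real.sqrt a : ℝ) : ℂ) ≠ 0 := by exact_mod_cast hsa.ne'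
      have hst' : ((Real.sqrt t : ℝ) : ℂ) ≠ 0 := by exact_mod_cast hst.ne'
      have hpi' : ((Real.pi : ℝ) : ℂ) ≠ 0 := by exact_mod_cast hpi.ne'
      have e : r z = z / msq z := by
        field_simp at hrz
        rw [eq_div_iff hm0]
        linear_combination hrz
      rw [e]
      simp only [Complex.ofReal_mul, Complex.ofReal_inv, Complex.ofReal_ofNat]
      field_simp
    have npre : ‖r z / (2 * Real.pi)‖ ≤ R1 / (2 * Real.pi) := by
      rw [norm_div, norm_mul, Complex.norm_real, Real.norm_of_nonneg hpi.le]
      simp only [Complex.norm_ofNat]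
      gcongr
    have p1 : ‖q n s z - Complex.ofReal ((n : ℝ) ^ (-(1 : ℝ) / 3)) *
            (Complex.ofReal (F (-(1 : ℝ) / 2) s) /
              (Complex.ofReal (2 * Real.pi * Real.sqrt a * Real.sqrt t) * msq z))‖
          ≤ C1 * (n : ℝ) ^ (-(2 : ℝ) / 3) := by
      rw [eT, hq', ← mul_sub, norm_mul, hC1, mul_assoc (R1 / (2 * Real.pi))]
      exact mul_le_mul npre h (norm_nonneg _) (by positivity)
    have p2 : ‖Complex.ofReal ((n : ℝ) ^ (-(1 : ℝ) / 3)) *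
            (Complex.ofReal (F (-(1 : ℝ) / 2) s) /
              (Complex.ofReal (2 * Real.pi * Real.sqrt a * Real.sqrt t) * msq z))‖
          ≤ C2 * (n : ℝ) ^ (-(1 : ℝ) / 3) := by
      have hFs : |F (-(1:ℝ)/2) s| ≤ B := by rw [hF]; exact hFB s hs
      rw [eT, norm_mul, hC2, mul_assoc (R1 / (2 * Real.pi))]
      refine mul_le_mul npre ?_ (norm_nonneg _) (by positivity)
      rw [norm_div, norm_mul, Complex.norm_real, Complex.norm_real, Real.norm_of_nonneg hsa.le,
        Real.norm_eq_abs, abs_mul, abs_of_nonneg (by positivity)]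
      calc _ ≤ (n:ℝ) ^ (-(1:ℝ)/3) * (Real.sqrt t)⁻¹ * B / (Real.sqrt a * d) := by gcongr
        _ = _ := by field_simp
    have hle : (n : ℝ) ^ (-(2 : ℝ) / 3) ≤ (n : ℝ) ^ (-(1 : ℝ) / 3) :=
      Real.rpow_le_rpow_of_exponent_le hn1 (by norm_num)
    constructor
    · refine p1.trans ?_
      gcongr
      linarith
    · calc ‖q n s z‖ ≤ _ := norm_le_norm_sub_add _ (Complex.ofReal ((n : ℝ) ^ (-(1 : ℝ) / 3)) *
            (Complex.ofReal (F (-(1 : ℝ) / 2) s) /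
              (Complex.ofReal (2 * Real.pi * Real.sqrt a * Real.sqrt t) * msq z)))
        _ ≤ C1 * (n : ℝ) ^ (-(2 : ℝ) / 3) + C2 * (n : ℝ) ^ (-(1 : ℝ) / 3) := add_le_add p1 p2
        _ ≤ C1 * (n : ℝ) ^ (-(1 : ℝ) / 3) + C2 * (n : ℝ) ^ (-(1 : ℝ) / 3) := by gcongr
        _ = _ := by ring
  obtain ⟨δ, hδ, hδS⟩ := hKc.exists_cthickening_subset_open hSo hKcS
  obtain ⟨C, hC, hfin⟩ := hmain _ hKc.cthickening hδS
  refine ⟨max C (C / δ), by positivity, 1, le_rfl, ?_⟩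
  intro n hn s hs z hz
  have hn0 : (0:ℝ) < n := by exact_mod_cast hn
  constructor
  · refine (hfin n hn s hs z (Metric.self_subset_cthickening _ hz)).1.trans ?_
    gcongr
    exact le_max_left _ _
  · have hcb : Metric.closedBall z δ ⊆ Metric.cthickening δ Kc := Metric.closedBall_subset_cthickening hz δ
    have hdiff : DifferentiableOn ℂ (q n s) S := by
      intro w hw
      have hI := aux_I_int a ha 1 s0 one_pos _ hGc (fun u hu => by
        have := (hQb u hu).1
        have := hu.1
        nlinarith) ((n:ℝ) ^ ((2:ℝ)/3)) s (by positivity) hs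
      have h1 := aux_diff a _ hI w (hS ▸ hw)
      have h2 : DifferentiableAt ℂ r w := (hr_an w hw).differentiableAt (hSo.mem_nhds hw)
      have h3 := (h2.div_const (2 * Real.pi : ℂ)).mul h1
      rw [show q n s = _ from funext (hq' n s)]
      exact h3.differentiableWithinAt
    have hdc : DiffContOnCl ℂ (q n s) (Metric.ball z δ) := by
      apply DifferentiableOn.diffContOnCl
      rw [closure_ball z hδ.ne']
      exact hdiff.mono (hcb.trans hδS)
    have h := Complex.norm_deriv_le_of_forall_mem_sphere_norm_le hδ hdc
      (fun w hw => (hfin n hn s hs w (hcb (Metric.sphere_subset_closedBall hw))).2)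
    refine h.trans ?_
    rw [mul_div_right_comm]
    gcongr
    exact le_max_right _ _
end

section
/- There exists δ_0 > 0 such that for every δ ∈ (0, δ_0] with the closed disk of radius 2δ contained in ψ(U), the following holds: there exist open connected sets S_0, S_1, S_2, S_3 ⊂ ℂ with S_j ⊃ Σ_j∖{0}, a function H_Q : S → ℂ where S = S_0 ∪ S_1 ∪ S_2 ∪ S_3, and constants η̂ > η > 0 and C > 0, such that (i) D_δ(0) ⊂ S and S_j ∩ S_k ⊂ D_δ(0) for all j ≠ k; (ii) H_Q is C^∞ on S (as a function of two real variables) and H_Q(w) = Q(ψ^{−1}(w)) for all |w| < δ; (iii) H_Q is analytic on D_δ(0), extends continuously to the closed disk, and |H_Q(w) + (t/c_V) w| ≤ C|w|² for all |w| ≤ δ; (iv) −η̂|w| ≤ Re H_Q(w) ≤ −η|w| for all w ∈ S_0∖D_δ(0), and Re H_Q(w) ≥ η|w| for all w ∈ (S_1 ∪ S_2 ∪ S_3)∖D_δ(0). -/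
open Filter Topology in
lemma aux_local (t cV : ℝ) (hcV : 0 < cV)
    (Q : ℂ → ℂ) (VQ : Set ℂ) (hVQopen : IsOpen VQ)
    (hQan : DifferentiableOn ℂ Q VQ) (hQ0 : Q 0 = 0)
    (hQder : deriv Q 0 = Complex.ofReal (-t))
    (U : Set ℂ) (hUopen : IsOpen U) (hU0 : (0 : ℂ) ∈ U) (hUV : U ⊆ VQ)
    (ψ : ℂ → ℂ) (hψinj : Set.InjOn ψ U) (hψan : DifferentiableOn ℂ ψ U)
    (hψ0 : ψ 0 = 0) (hψder : deriv ψ 0 = Complex.ofReal cV) :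
    ∃ (F : ℂ → ℂ) (r C : ℝ), 0 < r ∧ 0 < C ∧
      (∀ w, ‖w‖ < r → AnalyticAt ℂ F w) ∧
      (∀ w, ‖w‖ < r → ‖F w + Complex.ofReal (t / cV) * w‖ ≤ C * ‖w‖ ^ 2) ∧
      (∀ z ∈ U, ‖ψ z‖ < r → F (ψ z) = Q z) := by
  have hψA : AnalyticAt ℂ ψ 0 := hψan.analyticAt (hUopen.mem_nhds hU0)
  have hne : deriv ψ 0 ≠ 0 := by rw [hψder]; exact_mod_cast hcV.ne'
  have hcC : (cV : ℂ) ≠ 0 := by exact_mod_cast hcV.ne'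
  obtain ⟨g, hgA, hg0, hginv, hgd⟩ : ∃ g : ℂ → ℂ, AnalyticAt ℂ g 0 ∧ g 0 = 0 ∧
      (∀ᶠ w in 𝓝 (0 : ℂ), ψ (g w) = w) ∧ HasDerivAt g (cV : ℂ)⁻¹ 0 := by
    refine ⟨hψA.hasStrictDerivAt.localInverse _ _ _ hne, ?_, ?_, ?_, ?_⟩
    · have := hψA.analyticAt_localInverse hne
      rwa [hψ0] at this
    · have : (hψA.hasStrictDerivAt.localInverse _ _ _ hne) (ψ 0) = 0 :=
        HasStrictFDerivAt.localInverse_apply_image ..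
      rwa [hψ0] at this
    · have := hψA.hasStrictDerivAt.eventually_right_inverse hne
      rwa [hψ0] at this
    · have := (hψA.hasStrictDerivAt.to_localInverse hne).hasDerivAt
      rw [hψ0] at this
      exact this.congr_deriv (by rw [hψder])
  have hQA : AnalyticAt ℂ Q 0 := hQan.analyticAt (hVQopen.mem_nhds (hUV hU0))
  have hgU : ∀ᶠ w in 𝓝 (0 : ℂ), g w ∈ U := by
    apply hgA.continuousAt.eventually_mem
    rw [hg0]; exact hUopen.mem_nhds hU0
  have hFA : AnalyticAt ℂ (fun w => Q (g w)) 0 := by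
    apply AnalyticAt.fun_comp _ hgA
    rwa [hg0]
  have hFd : HasDerivAt (fun w => Q (g w)) (-(t : ℂ) * (cV : ℂ)⁻¹) 0 := by
    have hQ' : HasDerivAt Q (-(t : ℂ)) (g 0) := by
      rw [hg0]
      have := hQA.differentiableAt.hasDerivAt
      rw [hQder] at this
      simpa using this
    exact hQ'.comp 0 hgd
  have hGA : AnalyticAt ℂ (fun w => Q (g w) + Complex.ofReal (t / cV) * w) 0 :=
    hFA.add (analyticAt_const.mul analyticAt_id)
  have hGd : deriv (fun w => Q (g w) + Complex.ofReal (t / cV) * w) 0 = 0 := by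
    have := hFd.add ((hasDerivAt_id (0 : ℂ)).const_mul (Complex.ofReal (t / cV)))
    have h2 := this.deriv
    have h3 : -(t : ℂ) * (cV : ℂ)⁻¹ + Complex.ofReal (t / cV) * 1 = 0 := by
      push_cast; field_simp; ring
    rw [h3] at h2
    exact h2
  have hord : ((2 : ℕ) : ℕ∞) ≤
      analyticOrderAt (fun w => Q (g w) + Complex.ofReal (t / cV) * w) 0 := by
    rw [natCast_le_analyticOrderAt_iff_iteratedDeriv_eq_zero hGA]
    intro i hi
    interval_cases i
    · simp [hg0, hQ0]
    · rw [iteratedDeriv_one]; exact hGd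
  rw [natCast_le_analyticOrderAt hGA] at hord
  obtain ⟨k, hkA, hk⟩ := hord
  have hkb : ∀ᶠ w in 𝓝 (0 : ℂ), ‖k w‖ < ‖k 0‖ + 1 :=
    hkA.continuousAt.norm.eventually_lt_const (by linarith)
  have hall := hginv.and (hgU.and (hFA.eventually_analyticAt.and (hk.and hkb)))
  obtain ⟨r, hr, hr'⟩ := Metric.eventually_nhds_iff.1 hall
  refine ⟨fun w => Q (g w), r, ‖k 0‖ + 1, hr, by positivity, ?_, ?_, ?_⟩
  · intro w hw
    exact (hr' (by simpa using hw)).2.2.1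
  · intro w hw
    obtain ⟨-, -, -, h4, h5⟩ := hr' (y := w) (by simpa using hw)
    rw [h4]
    simp only [sub_zero, smul_eq_mul, norm_mul, norm_pow]
    rw [mul_comm]
    gcongr
  · intro z hz hzr
    obtain ⟨h1, h2, -⟩ := hr' (y := ψ z) (by simpa using hzr)
    have := hψinj h2 hz h1
    simp only [this]

/-- The open cone cut out by two linear inequalities, together with a disk. -/
def sec (δ p q p' q' : ℝ) : Set ℂ :=
  {w | 0 < p * w.re + q * w.im ∧ 0 < p' * w.re + q' * w.im} ∪ Metric.ball (0 : ℂ) δ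

lemma sec_open (δ p q p' q' : ℝ) : IsOpen (sec δ p q p' q') := by
  unfold sec
  refine IsOpen.union (IsOpen.and ?_ ?_) Metric.isOpen_ball
  · exact isOpen_lt continuous_const (by fun_prop)
  · exact isOpen_lt continuous_const (by fun_prop)

lemma sec_conn (δ p q p' q' : ℝ) (hδ : 0 < δ) : IsConnected (sec δ p q p' q') := by
  have h0 : (0 : ℂ) ∈ sec δ p q p' q' := Or.inr (by simpa using hδ)
  refine (StarConvex.isPathConnected (a := 0) ?_ h0).isConnected
  rw [starConvex_zero_iff]
  intro w hw a ha0 ha1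
  rcases ha0.eq_or_lt with rfl | ha
  · simpa using h0
  rcases hw with ⟨h1, h2⟩ | hw
  · left
    have e1 := mul_pos ha h1
    have e2 := mul_pos ha h2
    constructor <;> simp <;> linarith
  · right
    simp at hw ⊢
    rw [abs_of_pos ha]
    nlinarith [norm_nonneg w]

lemma contDiff_glue (a δ r : ℝ) (hr : 2 * δ < r) (F : ℂ → ℂ)
    (hF : ∀ w, ‖w‖ < r → AnalyticAt ℂ F w) (χ : ContDiffBump (0 : ℂ)) (hχ : χ.rOut = 2 * δ) :
    ContDiff ℝ (⊤ : ℕ∞) (fun w : ℂ => -((a : ℂ) * w) + (χ w) • (F w + (a : ℂ) * w)) := by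
  rw [contDiff_iff_contDiffAt]
  intro w
  by_cases hw : ‖w‖ < r
  · have h1 : ContDiffAt ℝ (⊤ : ℕ∞) F w := (hF w hw).contDiffAt.restrict_scalars ℝ
    have h2 : ContDiffAt ℝ (⊤ : ℕ∞) (fun w => χ w) w := χ.contDiffAt
    have h3 : ContDiffAt ℝ (⊤ : ℕ∞) (fun w : ℂ => (a : ℂ) * w) w :=
      contDiffAt_const.mul contDiffAt_id
    exact h3.neg.add (h2.smul (h1.add h3))
  · have h3 : ContDiffAt ℝ (⊤ : ℕ∞) (fun w : ℂ => -((a : ℂ) * w)) w :=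
      (contDiffAt_const.mul contDiffAt_id).neg
    refine h3.congr_of_eventuallyEq ?_
    have : ∀ᶠ v in nhds w, 2 * δ < ‖v‖ :=
      continuous_norm.continuousAt.eventually_const_lt (by linarith)
    filter_upwards [this] with v hv
    have : χ v = 0 := χ.zero_of_le_dist (by rw [hχ]; simpa using hv.le)
    simp [this]


/-- existence of the extension `H_Q` of `Q ∘ ψ⁻¹` with the sign properties
along neighborhoods of the four rays `Σ_j`. -/
theorem stmt_12
    (t cV : ℝ) (ht : 0 < t) (hcV : 0 < cV)
    (Q : ℂ → ℂ) (VQ : Set ℂ)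
    (hVQopen : IsOpen VQ) (hVQR : ∀ x : ℝ, (x : ℂ) ∈ VQ)
    (hQan : DifferentiableOn ℂ Q VQ)
    (hQreal : ∀ x : ℝ, (Q (x : ℂ)).im = 0)
    (hQneg : ∀ x : ℝ, x < 0 → 0 < (Q (x : ℂ)).re)
    (hQpos : ∀ x : ℝ, 0 < x → (Q (x : ℂ)).re < 0)
    (hQ0 : Q 0 = 0)
    (hQder : deriv Q 0 = Complex.ofReal (-t))
    (U : Set ℂ) (hUopen : IsOpen U) (hU0 : (0 : ℂ) ∈ U) (hUV : U ⊆ VQ)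
    (ψ : ℂ → ℂ) (hψinj : Set.InjOn ψ U) (hψan : DifferentiableOn ℂ ψ U)
    (hψ0 : ψ 0 = 0) (hψder : deriv ψ 0 = Complex.ofReal cV)
    (hψreal : ∀ x : ℝ, (x : ℂ) ∈ U → (ψ (x : ℂ)).im = 0) :
    ∃ δ0 : ℝ, 0 < δ0 ∧
      ∀ δ : ℝ, 0 < δ → δ ≤ δ0 → Metric.closedBall (0 : ℂ) (2 * δ) ⊆ ψ '' U →
        ∃ (S0 S1 S2 S3 : Set ℂ) (HQ : ℂ → ℂ) (η ηhat C : ℝ),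
          IsOpen S0 ∧ IsConnected S0 ∧ IsOpen S1 ∧ IsConnected S1 ∧
          IsOpen S2 ∧ IsConnected S2 ∧ IsOpen S3 ∧ IsConnected S3 ∧
          (∀ x : ℝ, 0 < x → (x : ℂ) ∈ S0) ∧
          (∀ x : ℝ, 0 < x →
            (x : ℂ) * Complex.exp (Complex.ofReal (2 * Real.pi / 3) * Complex.I) ∈ S1) ∧
          (∀ x : ℝ, x < 0 → (x : ℂ) ∈ S2) ∧
          (∀ x : ℝ, 0 < x →
            (x : ℂ) * Complex.exp (Complex.ofReal (-(2 * Real.pi) / 3) * Complex.I) ∈ S3) ∧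
          Metric.ball (0 : ℂ) δ ⊆ S0 ∪ S1 ∪ S2 ∪ S3 ∧
          S0 ∩ S1 ⊆ Metric.ball (0 : ℂ) δ ∧ S0 ∩ S2 ⊆ Metric.ball (0 : ℂ) δ ∧
          S0 ∩ S3 ⊆ Metric.ball (0 : ℂ) δ ∧ S1 ∩ S2 ⊆ Metric.ball (0 : ℂ) δ ∧
          S1 ∩ S3 ⊆ Metric.ball (0 : ℂ) δ ∧ S2 ∩ S3 ⊆ Metric.ball (0 : ℂ) δ ∧
          ContDiffOn ℝ (⊤ : ℕ∞) HQ (S0 ∪ S1 ∪ S2 ∪ S3) ∧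
          (∀ z ∈ U, ‖ψ z‖ < δ → HQ (ψ z) = Q z) ∧
          DifferentiableOn ℂ HQ (Metric.ball (0 : ℂ) δ) ∧
          ContinuousOn HQ (Metric.closedBall (0 : ℂ) δ) ∧
          0 < C ∧
          (∀ w : ℂ, ‖w‖ ≤ δ →
            ‖HQ w + Complex.ofReal (t / cV) * w‖ ≤ C * ‖w‖ ^ 2) ∧
          0 < η ∧ η < ηhat ∧
          (∀ w ∈ S0, w ∉ Metric.ball (0 : ℂ) δ →
            -ηhat * ‖w‖ ≤ (HQ w).re ∧ (HQ w).re ≤ -η * ‖w‖) ∧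
          (∀ w ∈ S1 ∪ S2 ∪ S3, w ∉ Metric.ball (0 : ℂ) δ → η * ‖w‖ ≤ (HQ w).re) := by

  obtain ⟨F, r, C, hr, hC, hFA, hFb, hFQ⟩ := aux_local t cV hcV Q VQ hVQopen hQan hQ0 hQder
    U hUopen hU0 hUV ψ hψinj hψan hψ0 hψder
  have ha : 0 < t / cV := div_pos ht hcV
  generalize t / cV = a at *
  refine ⟨min (r / 4) (a / (20 * C)), by positivity, ?_⟩
  intro δ hδ hδ0 _
  have hδr : 2 * δ < r := by
    have := hδ0.trans (min_le_left _ _); linarith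
  have hδC : C * (2 * δ) ≤ a / 10 := by
    have := hδ0.trans (min_le_right _ _)
    rw [le_div_iff₀ (by positivity)] at this; linarith
  let χ : ContDiffBump (0 : ℂ) := ⟨δ, 2 * δ, hδ, by linarith⟩
  have hχ1 : ∀ w : ℂ, ‖w‖ ≤ δ → χ w = 1 := fun w hw =>
    χ.one_of_mem_closedBall (by simpa using hw)
  have hχ0 : ∀ w : ℂ, 2 * δ ≤ ‖w‖ → χ w = 0 := fun w hw =>
    χ.zero_of_le_dist (by simpa using hw)
  obtain ⟨H, hH⟩ : ∃ H : ℂ → ℂ,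
      H = (fun w : ℂ => -((a : ℂ) * w) + (χ w) • (F w + (a : ℂ) * w)) := ⟨_, rfl⟩
  have hHs : ContDiff ℝ (⊤ : ℕ∞) H := by
    rw [hH]; exact contDiff_glue a δ r hδr F hFA χ rfl
  have hHF : ∀ w : ℂ, ‖w‖ ≤ δ → H w = F w := by
    intro w hw
    simp [hH, hχ1 w hw]
  have hHe : ∀ w : ℂ, ‖H w + (a : ℂ) * w‖ ≤ a / 10 * ‖w‖ := by
    intro w
    have e : H w + (a : ℂ) * w = (χ w) • (F w + (a : ℂ) * w) := by rw [hH]; ring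
    rw [e]
    rcases lt_or_ge ‖w‖ (2 * δ) with hw | hw
    · have h1 := hFb w (by linarith)
      rw [norm_smul, Real.norm_of_nonneg χ.nonneg]
      calc χ w * ‖F w + (a : ℂ) * w‖ ≤ 1 * ‖F w + (a : ℂ) * w‖ := by
            gcongr; exact χ.le_one
        _ ≤ C * ‖w‖ * ‖w‖ := by rw [one_mul]; linarith
        _ ≤ a / 10 * ‖w‖ := by
            gcongr
            exact le_trans (by gcongr) hδC
    · rw [hχ0 w hw]; simp; positivity
  have hre : ∀ w : ℂ, |(H w).re + a * w.re| ≤ a / 10 * ‖w‖ := by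
    intro w
    have := (Complex.abs_re_le_norm (H w + (a : ℂ) * w)).trans (hHe w)
    simpa using this
  have hn : ∀ w : ℂ, ‖w‖ ≤ |w.re| + |w.im| := Complex.norm_le_abs_re_add_abs_im
  have c3 : Real.cos (2 * Real.pi / 3) = -(1 / 2) := by
    rw [show 2 * Real.pi / 3 = Real.pi - Real.pi / 3 by ring, Real.cos_pi_sub, Real.cos_pi_div_three]
  have s3 : Real.sin (2 * Real.pi / 3) = √3 / 2 := by
    rw [show 2 * Real.pi / 3 = Real.pi - Real.pi / 3 by ring, Real.sin_pi_sub, Real.sin_pi_div_three]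
  have q1 : 1 < √3 := by rw [Real.lt_sqrt] <;> norm_num
  have q2 : √3 < 2 := by rw [Real.sqrt_lt'] <;> norm_num
  have hneg : -(2 * Real.pi) / 3 = -(2 * Real.pi / 3) := by ring
  refine ⟨sec δ 1 1 1 (-1), sec δ 1 1 (-4) (-1), sec δ (-1) 1 (-1) (-1), sec δ 1 (-1) (-4) 1,
    H, a / 10, 2 * a, C, sec_open _ _ _ _ _, sec_conn _ _ _ _ _ hδ, sec_open _ _ _ _ _, sec_conn _ _ _ _ _ hδ,
    sec_open _ _ _ _ _, sec_conn _ _ _ _ _ hδ, sec_open _ _ _ _ _, sec_conn _ _ _ _ _ hδ,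
    ?_, ?_, ?_, ?_, ?_, ?_, ?_, ?_, ?_, ?_, ?_, hHs.contDiffOn, ?_, ?_,
    hHs.continuous.continuousOn, hC, ?_, by positivity, by linarith, ?_, ?_⟩
  · intro x hx; left; simp [hx]
  · intro x hx; left
    simp only [Set.mem_ofPred_eq, Complex.re_ofReal_mul, Complex.im_ofReal_mul,
      Complex.exp_ofReal_mul_I_re, Complex.exp_ofReal_mul_I_im, c3, s3]
    constructor <;> nlinarith
  · intro x hx; left; simp [hx]
  · intro x hx; left
    simp only [Set.mem_ofPred_eq, Complex.re_ofReal_mul, Complex.im_ofReal_mul,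
      Complex.exp_ofReal_mul_I_re, Complex.exp_ofReal_mul_I_im, hneg, Real.cos_neg, Real.sin_neg,
      c3, s3]
    constructor <;> nlinarith
  · intro w hw; exact Or.inr (Or.inr hw)
  iterate 6
    · rintro w ⟨⟨h1, h2⟩ | h1, ⟨h3, h4⟩ | h3⟩
      · exfalso; linarith
      all_goals assumption
  · intro z hz hzd
    rw [hHF _ hzd.le]
    exact hFQ z hz (by linarith)
  · intro w hw
    have hw' : ‖w‖ < δ := by simpa using hw
    have : DifferentiableOn ℂ F (Metric.ball 0 δ) := fun v hv =>
      (hFA v (by have : ‖v‖ < δ := by simpa using hv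
                 linarith)).differentiableAt.differentiableWithinAt
    exact this.congr (fun v hv => hHF v (by simpa using (Metric.mem_ball.1 hv).le)) w hw
  · intro w hw
    rw [hHF w hw]; exact hFb w (by linarith)
  · rintro w (⟨h1, h2⟩ | hw) hw'
    swap
    · exact absurd hw hw'
    have h3 := abs_le.1 (hre w)
    have h4 := hn w
    have h5 := Complex.abs_re_le_norm w
    have h6 : |w.im| ≤ w.re := abs_le.2 ⟨by linarith, by linarith⟩
    have h7 : 0 < w.re := by linarith
    rw [abs_of_pos h7] at h4 h5
    have h8 : ‖w‖ ≤ 2 * w.re := by linarith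
    have h9 := mul_le_mul_of_nonneg_left h8 ha.le
    have h10 := mul_le_mul_of_nonneg_left h5 ha.le
    have h11 := mul_nonneg ha.le (norm_nonneg w)
    constructor <;> linarith
  · have key : ∀ w : ℂ, ‖w‖ ≤ -5 * w.re → a / 10 * ‖w‖ ≤ (H w).re := by
      intro w h8
      have h3 := abs_le.1 (hre w)
      have h9 := mul_le_mul_of_nonneg_left h8 ha.le
      linarith
    rintro w (((⟨h1, h2⟩ | hw) | (⟨h1, h2⟩ | hw)) | (⟨h1, h2⟩ | hw)) hw'
    · refine key w ((hn w).trans ?_)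
      rw [abs_of_nonpos (by linarith : w.re ≤ 0), abs_of_nonneg (by linarith : 0 ≤ w.im)]
      linarith
    · exact absurd hw hw'
    · refine key w ((hn w).trans ?_)
      have : |w.im| ≤ -w.re := abs_le.2 ⟨by linarith, by linarith⟩
      rw [abs_of_nonpos (by linarith : w.re ≤ 0)]
      linarith
    · exact absurd hw hw'
    · refine key w ((hn w).trans ?_)
      rw [abs_of_nonpos (by linarith : w.re ≤ 0), abs_of_nonpos (by linarith : w.im ≤ 0)]
      linarith
    · exact absurd hw hw'
end

section
/- Let a > 0, 0 < δ < a, and let ψ be analytic and injective on the disk D_δ(0) with ψ(0) = 0, ψ'(0) > 0 and ψ(D_δ(0) ∩ ℝ) ⊂ ℝ. Set m(z) = z/(z+a). Then for z ∈ D_δ(0)∖(−∞,0] both m(z) and ψ(z) lie in ℂ∖(−∞,0], the function h(z) = m(z)^{1/4} · ψ(z)^{−1/4} (principal branches of the fourth root) is analytic there, and h extends to an analytic function on all of D_δ(0), whose value at 0 equals (a·ψ'(0))^{−1/4} and which satisfies h(z)⁴ = m(z)/ψ(z) for z ≠ 0. -/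
theorem aux_ivt (f : ℝ → ℝ) (hf : ContinuousOn f (Set.Icc 0 1)) (h0 : 0 < f 0)
    (hn : ∀ t ∈ Set.Icc (0:ℝ) 1, f t ≠ 0) : 0 < f 1 := by
  by_contra h
  push Not at h
  obtain ⟨t, ht, h2⟩ := intermediate_value_Icc' (zero_le_one) hf ⟨h, h0.le⟩
  exact hn t ht h2

theorem aux_log (u v : ℂ) (hu : u ∈ Complex.slitPlane) (hv : v ∈ Complex.slitPlane)
    (h : (0 ≤ u.im ∧ 0 ≤ v.im) ∨ (u.im ≤ 0 ∧ v.im ≤ 0)) :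
    Complex.log (u / v) = Complex.log u - Complex.log v := by
  have hu0 := Complex.slitPlane_ne_zero hu
  have hv0 := Complex.slitPlane_ne_zero hv
  have h1 : Complex.exp (Complex.log u - Complex.log v) = u / v := by
    rw [Complex.exp_sub, Complex.exp_log hu0, Complex.exp_log hv0]
  have hup := lt_of_le_of_ne (Complex.arg_le_pi u) (Complex.mem_slitPlane_iff_arg.1 hu).1
  have hvp := lt_of_le_of_ne (Complex.arg_le_pi v) (Complex.mem_slitPlane_iff_arg.1 hv).1
  have hun := Complex.neg_pi_lt_arg u
  have hvn := Complex.neg_pi_lt_arg v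
  have key : -Real.pi < u.arg - v.arg ∧ u.arg - v.arg < Real.pi := by
    rcases h with ⟨a, b⟩ | ⟨a, b⟩
    · have := Complex.arg_nonneg_iff.2 a
      have := Complex.arg_nonneg_iff.2 b
      constructor <;> linarith
    · have q : ∀ w : ℂ, w ∈ Complex.slitPlane → w.im ≤ 0 → w.arg ≤ 0 := by
        intro w hw hi
        rcases hi.lt_or_eq with hi | hi
        · exact (Complex.arg_neg_iff.2 hi).le
        · refine (Complex.arg_eq_zero_iff.2 ⟨?_, hi⟩).le
          rcases hw with hw | hw
          · exact hw.le
          · exact absurd hi hw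
      have := q u hu a
      have := q v hv b
      constructor <;> linarith
  rw [← h1, Complex.log_exp]
  · simpa [Complex.log_im] using key.1
  · simpa [Complex.log_im] using key.2.le

theorem aux_refl (δ : ℝ) (hδ0 : 0 < δ) (ψ : ℂ → ℂ)
    (hψan : DifferentiableOn ℂ ψ (Metric.ball (0 : ℂ) δ))
    (hψreal : ∀ x : ℝ, (x : ℂ) ∈ Metric.ball (0 : ℂ) δ → (ψ (x : ℂ)).im = 0) 
    (z : ℂ) (hz : z ∈ Metric.ball (0 : ℂ) δ) :
    (starRingEnd ℂ) (ψ ((starRingEnd ℂ) z)) = ψ z := by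
  have hd : DifferentiableOn ℂ (fun z => (starRingEnd ℂ) (ψ ((starRingEnd ℂ) z)))
      (Metric.ball (0 : ℂ) δ) := by
    intro w hw
    have hw' : (starRingEnd ℂ) w ∈ Metric.ball (0 : ℂ) δ := by simpa using hw
    have := (hψan.differentiableAt (Metric.isOpen_ball.mem_nhds hw')).conj_conj
    simp only [Complex.conj_conj] at this
    exact this.differentiableWithinAt
  have A := hd.analyticOnNhd Metric.isOpen_ball
  have B := hψan.analyticOnNhd Metric.isOpen_ball
  refine A.eqOn_of_preconnected_of_frequently_eq B (convex_ball _ _).isPreconnected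
    (Metric.mem_ball_self hδ0) ?_ hz
  have T : Filter.Tendsto (fun x : ℝ => (x : ℂ)) (nhdsWithin 0 (Set.Ioi 0))
      (nhdsWithin 0 {0}ᶜ) := by
    rw [tendsto_nhdsWithin_iff]
    constructor
    · have : Filter.Tendsto (fun x : ℝ => (x : ℂ)) (nhds 0) (nhds ((0:ℝ):ℂ)) :=
        Complex.continuous_ofReal.tendsto 0
      rw [Complex.ofReal_zero] at this
      exact this.mono_left nhdsWithin_le_nhds
    · filter_upwards [self_mem_nhdsWithin] with x hx
      simpa using (ne_of_gt hx : x ≠ 0)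
  refine T.frequently (Filter.Eventually.frequently ?_)
  filter_upwards [Ioo_mem_nhdsGT hδ0] with x hx
  have hxb : (x : ℂ) ∈ Metric.ball (0 : ℂ) δ := by
    simp [abs_of_pos hx.1, hx.2]
  simp only [Complex.conj_ofReal]
  exact Complex.conj_eq_iff_im.2 (hψreal x hxb)

/-- analyticity of the prefactor `h(z) = m(z)^{1/4} ψ(z)^{-1/4}` on the slit disk
and its analytic extension `H` across the slit, with `H(0) = (a ψ'(0))^{-1/4}` and
`H(z)⁴ = m(z)/ψ(z)` for `z ≠ 0`. -/
theorem stmt_14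
    (a δ : ℝ) (ha : 0 < a) (hδ0 : 0 < δ) (hδa : δ < a)
    (ψ : ℂ → ℂ)
    (hψan : DifferentiableOn ℂ ψ (Metric.ball (0 : ℂ) δ))
    (hψinj : Set.InjOn ψ (Metric.ball (0 : ℂ) δ))
    (hψ0 : ψ 0 = 0)
    (c : ℝ) (hc : 0 < c) (hψder : deriv ψ 0 = Complex.ofReal c)
    (hψreal : ∀ x : ℝ, (x : ℂ) ∈ Metric.ball (0 : ℂ) δ → (ψ (x : ℂ)).im = 0)
    (m : ℂ → ℂ) (hm : ∀ z, m z = z / (z + Complex.ofReal a)) :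
    (∀ z ∈ Metric.ball (0 : ℂ) δ \ {w : ℂ | w.im = 0 ∧ w.re ≤ 0},
      m z ∉ {w : ℂ | w.im = 0 ∧ w.re ≤ 0} ∧ ψ z ∉ {w : ℂ | w.im = 0 ∧ w.re ≤ 0}) ∧
    DifferentiableOn ℂ (fun z => m z ^ ((1 : ℂ) / 4) * ψ z ^ (-(1 : ℂ) / 4))
      (Metric.ball (0 : ℂ) δ \ {w : ℂ | w.im = 0 ∧ w.re ≤ 0}) ∧
    ∃ H : ℂ → ℂ,
      DifferentiableOn ℂ H (Metric.ball (0 : ℂ) δ) ∧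
      (∀ z ∈ Metric.ball (0 : ℂ) δ \ {w : ℂ | w.im = 0 ∧ w.re ≤ 0},
        H z = m z ^ ((1 : ℂ) / 4) * ψ z ^ (-(1 : ℂ) / 4)) ∧
      H 0 = Complex.ofReal ((a * c) ^ (-(1 : ℝ) / 4)) ∧
      ∀ z ∈ Metric.ball (0 : ℂ) δ, z ≠ 0 → (H z) ^ 4 = m z / ψ z := by
  set B := Metric.ball (0 : ℂ) δ with hB
  have h0B : (0:ℂ) ∈ B := Metric.mem_ball_self hδ0
  set φ : ℂ → ℂ := dslope ψ 0 with hφ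
  have hφd : DifferentiableOn ℂ φ B :=
    (Complex.differentiableOn_dslope (Metric.isOpen_ball.mem_nhds h0B)).2 hψan
  have hφ0 : φ 0 = c := by rw [hφ, dslope_same, hψder]
  have hmul : ∀ z, z * φ z = ψ z := by
    intro z
    have := sub_smul_dslope ψ 0 z
    simpa [hψ0] using this
  have hψne : ∀ z ∈ B, z ≠ 0 → ψ z ≠ 0 := fun z hz h h' =>
    h (hψinj hz h0B (h'.trans hψ0.symm))
  have hφne : ∀ z ∈ B, φ z ≠ 0 := by
    intro z hz h
    by_cases h0 : z = 0
    · subst h0; rw [hφ0] at h; exact hc.ne' (by exact_mod_cast h)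
    · exact hψne z hz h0 (by rw [← hmul, h, mul_zero])
  have him : ∀ z ∈ B, z.im ≠ 0 → (ψ z).im ≠ 0 := by
    intro z hz hi h
    have h1 := aux_refl δ hδ0 ψ hψan hψreal z hz
    have h2 : ψ ((starRingEnd ℂ) z) = ψ z := by
      rw [← Complex.conj_eq_iff_im.2 h, ← h1, Complex.conj_conj]
    have hz' : (starRingEnd ℂ) z ∈ B := by simpa [hB] using hz
    exact hi (Complex.conj_eq_iff_im.1 (hψinj hz' hz h2))
  have htB : ∀ z ∈ B, ∀ t ∈ Set.Icc (0:ℝ) 1, (t:ℂ) * z ∈ B := by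
    intro z hz t ht
    simp only [hB, mem_ball_zero_iff, norm_mul, Complex.norm_real, Real.norm_eq_abs,
      abs_of_nonneg ht.1] at hz ⊢
    nlinarith [ht.2, norm_nonneg z]
  have hcont : ∀ z ∈ B, ContinuousOn (fun t : ℝ => φ ((t:ℂ) * z)) (Set.Icc 0 1) := by
    intro z hz
    exact hφd.continuousOn.comp (by fun_prop) (fun t ht => htB z hz t ht)
  have hsign : ∀ z ∈ B, z.im ≠ 0 → 0 < z.im * (ψ z).im := by
    intro z hz hi
    have := aux_ivt (fun t : ℝ => z.im * (z * φ ((t:ℂ) * z)).im) ?_ ?_ ?_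
    · simpa [hmul] using this
    · exact continuousOn_const.mul
        (Complex.continuous_im.comp_continuousOn (continuousOn_const.mul (hcont z hz)))
    · have : 0 < z.im * z.im * c := mul_pos (mul_self_pos.2 hi) hc
      simp [hφ0]; linarith
    · intro t ht h
      rcases ht.1.lt_or_eq with h0 | h0
      · refine him _ (htB z hz t ht) (by simp [h0.ne', hi]) ?_
        rw [← hmul, mul_assoc, Complex.im_ofReal_mul, (mul_eq_zero.1 h).resolve_left hi, mul_zero]
      · subst h0
        simp [hφ0, hi, hc.ne'] at h
  have hφreal : ∀ x : ℝ, (x:ℂ) ∈ B → (φ x).im = 0 := by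
    intro x hx
    by_cases h0 : x = 0
    · subst h0; simp [hφ0]
    · have := hψreal x hx
      rw [← hmul, Complex.im_ofReal_mul] at this
      exact (mul_eq_zero.1 this).resolve_left h0
  have hpos : ∀ z ∈ B, z.im = 0 → 0 < (φ z).re ∧ (φ z).im = 0 := by
    intro z hz hi
    obtain ⟨x, rfl⟩ : ∃ x : ℝ, z = x := ⟨z.re, Complex.ext (by simp) (by simp [hi])⟩
    refine ⟨?_, hφreal x hz⟩
    have := aux_ivt (fun t : ℝ => (φ ((t:ℂ) * x)).re) ?_ ?_ ?_
    · simpa using this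
    · exact Complex.continuous_re.comp_continuousOn (hcont _ hz)
    · simpa [hφ0] using hc
    · intro t ht h
      have hb := htB _ hz t ht
      refine hφne _ hb (Complex.ext h ?_)
      have := hφreal (t * x) (by simpa using hb)
      simpa using this
  have hslit : ∀ z : ℂ, z ∉ {w : ℂ | w.im = 0 ∧ w.re ≤ 0} ↔ z ∈ Complex.slitPlane := by
    intro z
    rw [Complex.mem_slitPlane_iff, Set.mem_setOf_eq, not_and_or, not_le, or_comm]
  have hφs : ∀ z ∈ B, φ z ∈ Complex.slitPlane := by
    intro z hz
    by_cases hi : z.im = 0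
    · exact Or.inl (hpos z hz hi).1
    · rw [← hslit]
      rintro ⟨h1, h2⟩
      have := hsign z hz hi
      rw [← hmul, Complex.mul_im, h1] at this
      nlinarith [mul_self_nonneg z.im]
  have hare : ∀ z ∈ B, 0 < (z + a).re := by
    intro z hz
    have h1 : ‖z‖ < δ := by simpa [hB] using hz
    have := (abs_le.1 (Complex.abs_re_le_norm z)).1
    simp; linarith
  have has : ∀ z ∈ B, z + a ∈ Complex.slitPlane := fun z hz => Or.inl (hare z hz)
  have hψs : ∀ z ∈ B, z ∈ Complex.slitPlane → ψ z ∈ Complex.slitPlane := by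
    intro z hz hs
    by_cases hi : z.im = 0
    · left
      have hr := hs.resolve_right (by simpa using hi)
      rw [← hmul, Complex.mul_re, hi]
      have := mul_pos hr (hpos z hz hi).1
      linarith
    · exact Or.inr (him z hz hi)
  have hms : ∀ z ∈ B, z ∈ Complex.slitPlane → m z ∈ Complex.slitPlane := by
    intro z hz hs
    have hn : 0 < Complex.normSq (z + a) :=
      Complex.normSq_pos.2 (Complex.slitPlane_ne_zero (has z hz))
    by_cases hi : z.im = 0
    · left
      have hr := hs.resolve_right (by simpa using hi)
      rw [hm, Complex.div_re]
      have := div_pos (mul_pos hr (hare z hz)) hn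
      simpa [hi] using this
    · right
      rw [hm, Complex.div_im, ← sub_div]
      refine div_ne_zero ?_ hn.ne'
      have : z.im * (z + a).re - z.re * (z + a).im = z.im * a := by simp; ring
      rw [this]
      exact mul_ne_zero hi ha.ne'
  set H : ℂ → ℂ := fun z => (z + a) ^ (-(1:ℂ)/4) * φ z ^ (-(1:ℂ)/4) with hH
  have hHd : DifferentiableOn ℂ H B := by
    refine DifferentiableOn.mul ?_ ?_
    · exact DifferentiableOn.cpow (by fun_prop) (by fun_prop) has
    · exact DifferentiableOn.cpow hφd (by fun_prop) hφs
  have hHh : ∀ z ∈ B \ {w : ℂ | w.im = 0 ∧ w.re ≤ 0},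
        H z = m z ^ ((1 : ℂ) / 4) * ψ z ^ (-(1 : ℂ) / 4) := by
    rintro z ⟨hz, hs⟩
    rw [hslit] at hs
    have hz0 := Complex.slitPlane_ne_zero hs
    have l1 : Complex.log (m z) = Complex.log z - Complex.log (z + a) := by
      rw [hm]
      refine aux_log _ _ hs (has z hz) ?_
      rcases le_total 0 z.im with h | h
      · left; simpa using h
      · right; simpa using h
    have l2 : Complex.log (φ z) = Complex.log (ψ z) - Complex.log z := by
      have : φ z = ψ z / z := by rw [← hmul]; field_simp
      rw [this]
      refine aux_log _ _ (hψs z hz hs) hs ?_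
      by_cases hi : z.im = 0
      · have h3 : (ψ z).im = 0 := by
          rw [← hmul, Complex.mul_im, hi, (hpos z hz hi).2]; simp
        left; rw [hi, h3]; simp
      · have := hsign z hz hi
        rcases pos_and_pos_or_neg_and_neg_of_mul_pos this with h | h
        · exact Or.inl ⟨h.2.le, h.1.le⟩
        · exact Or.inr ⟨h.2.le, h.1.le⟩
    simp only [hH]
    rw [Complex.cpow_def_of_ne_zero (Complex.slitPlane_ne_zero (has z hz)),
      Complex.cpow_def_of_ne_zero (hφne z hz),
      Complex.cpow_def_of_ne_zero (Complex.slitPlane_ne_zero (hms z hz hs)),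
      Complex.cpow_def_of_ne_zero (hψne z hz hz0), ← Complex.exp_add, ← Complex.exp_add, l1, l2]
    congr 1
    ring
  refine ⟨?_, hHd.mono Set.diff_subset |>.congr (fun z hz => (hHh z hz).symm), H, hHd, hHh, ?_, ?_⟩
  · rintro z ⟨hz, hs⟩
    rw [hslit] at hs
    rw [hslit, hslit]
    exact ⟨hms z hz hs, hψs z hz hs⟩
  · simp only [hH]
    rw [hφ0, zero_add, Real.mul_rpow ha.le hc.le, Complex.ofReal_mul,
      Complex.ofReal_cpow ha.le, Complex.ofReal_cpow hc.le]
    push_cast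
    rfl
  · intro z hz hz0
    have q : ∀ w : ℂ, w ≠ 0 → (w ^ (-(1:ℂ)/4)) ^ 4 = w⁻¹ := by
      intro w hw
      rw [← Complex.cpow_mul_nat, ← Complex.cpow_neg_one]
      congr 1
      push_cast
      ring
    simp only [hH]
    have h1 := Complex.slitPlane_ne_zero (has z hz)
    have h2 := hφne z hz
    rw [mul_pow, q _ h1, q _ h2, hm, ← hmul]
    field_simp
end
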